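/- Let R be a commutative ring in which q(q²−1) is invertible and let r ≥ 0. In the group algebra R[G_{r+6}] set e = e_{r+6,r}, T₁ = q²·e·σ₁·e with σ₁ the permutation matrix of (2,3)(r+4,r+5), and T₂ = q²·e·σ₂·e with σ₂ the permutation matrix of (1,2)(r+5,r+6). Then the braid relation T₁·T₂·T₁ = T₂·T₁·T₂ holds. -/

import Mathlib

open scoped MatrixGroups Matrix

noncomputable section

variable (F : Type*) [Field F]

/-- The anti-diagonal matrix `J` with entries 1 at positions `(i, n-1-i)`. -/
def Jmat (n : ℕ) : Matrix (Fin n) (Fin n) F :=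
  Matrix.of fun i j => if j = Fin.rev i then 1 else 0

lemma Jmat_mul_self (n : ℕ) : Jmat F n * Jmat F n = 1 := by
  ext i j
  rw [Matrix.mul_apply]
  simp only [Jmat, Matrix.of_apply, Matrix.one_apply]
  rw [Finset.sum_eq_single (Fin.rev i)]
  · simp [Fin.rev_rev, eq_comm]
  · intro k _ hk
    rw [if_neg hk, zero_mul]
  · exact fun h => absurd (Finset.mem_univ _) h

/-- `J` as an element of the general linear group. -/
def Junit (n : ℕ) : GL (Fin n) F :=
  ⟨Jmat F n, Jmat F n, Jmat_mul_self F n, Jmat_mul_self F n⟩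

/-- The group automorphism `g ↦ ᵗg⁻¹` of `GL_n`. -/
def transposeInvHom (n : ℕ) : GL (Fin n) F →* GL (Fin n) F where
  toFun g := ⟨(g⁻¹).valᵀ, g.valᵀ,
    by rw [← Matrix.transpose_mul, ← Units.val_mul, mul_inv_cancel, Units.val_one,
      Matrix.transpose_one],
    by rw [← Matrix.transpose_mul, ← Units.val_mul, inv_mul_cancel, Units.val_one,
      Matrix.transpose_one]⟩
  map_one' := by
    apply Units.ext
    show ((1 : GL (Fin n) F)⁻¹).valᵀ = _
    simp
  map_mul' g h := by
    apply Units.ext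
    show ((g * h)⁻¹).valᵀ = (g⁻¹).valᵀ * (h⁻¹).valᵀ
    rw [mul_inv_rev, Units.val_mul, Matrix.transpose_mul]

/-- The twisted Frobenius endomorphism `g ↦ J · ᵗ(φ(g))⁻¹ · J` of `GL_n(F)`,
where `φ` is the `q`-power Frobenius. -/
def twistedFrobenius (φ : F →+* F) (n : ℕ) : GL (Fin n) F →* GL (Fin n) F :=
  (MulAut.conj (Junit F n)).toMonoidHom.comp
    ((transposeInvHom F n).comp (Matrix.GeneralLinearGroup.map φ))

/-- The finite unitary group `GU_n(q)`, as the subgroup of `GL_n(𝔽_{q²})` of fixed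
points of the twisted Frobenius, i.e. `g = J · ᵗ(g^{(q)})⁻¹ · J`. -/
def GU (φ : F →+* F) (n : ℕ) : Subgroup (GL (Fin n) F) where
  carrier := {g | twistedFrobenius F φ n g = g}
  one_mem' := by simp
  mul_mem' := by
    intro a b ha hb
    simp only [Set.mem_setOf_eq] at *
    rw [map_mul, ha, hb]
  inv_mem' := by
    intro a ha
    simp only [Set.mem_setOf_eq] at *
    rw [map_inv, ha]

/-- The permutation matrix of a permutation `w`. -/
def permMat (n : ℕ) (w : Equiv.Perm (Fin n)) : Matrix (Fin n) (Fin n) F :=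
  Matrix.of fun i j => if w i = j then 1 else 0

/-- The set of matrices underlying the subgroup `U_r ≤ G_{r+2}`: upper triangular
matrices whose middle `r × r` block is the identity. -/
def UrSet (r : ℕ) : Set (Matrix (Fin (r + 2)) (Fin (r + 2)) F) :=
  {g | (∀ i j : Fin (r + 2), (j : ℕ) < (i : ℕ) → g i j = 0) ∧
       (∀ i : Fin (r + 2), 1 ≤ (i : ℕ) → (i : ℕ) ≤ r → g i i = 1) ∧
       (∀ i j : Fin (r + 2), 1 ≤ (i : ℕ) → (i : ℕ) < (j : ℕ) → (j : ℕ) ≤ r → g i j = 0)}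

/-- Entries of the `o`-fold middle-block (centered) embedding of a matrix. -/
def cembFun {a : ℕ} (o : ℕ) (u : Matrix (Fin a) (Fin a) F) (p q : ℕ) : F :=
  if h : o ≤ p ∧ p < o + a ∧ o ≤ q ∧ q < o + a then
    u ⟨p - o, by omega⟩ ⟨q - o, by omega⟩
  else if p = q then 1 else 0

/-- The subgroup `U_{n,r} ≤ G_n` (for `n = r + 2m`), generated by `U_{n-2}` together with
the images of `U_{n-4}, …, U_r` under the iterated middle-block embeddings. -/
def Unr (φ : F →+* F) (r m : ℕ) : Subgroup (GU F φ (r + 2 * m)) :=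
  Subgroup.closure
    {g | ∃ k : ℕ, k < m ∧
      ∃ u : Matrix (Fin (r + 2 * k + 2)) (Fin (r + 2 * k + 2)) F,
        u ∈ UrSet F (r + 2 * k) ∧
        ∀ p q : Fin (r + 2 * m),
          ((g : GL (Fin (r + 2 * m)) F) : Matrix (Fin (r + 2 * m)) (Fin (r + 2 * m)) F) p q
            = cembFun F (m - 1 - k) u (p : ℕ) (q : ℕ)}

/-- The idempotent `e_S = |S|⁻¹ ∑_{g ∈ S} g` in the group algebra `R[G]`. -/
def eSub (R : Type*) [CommRing R] {G : Type*} [Group G] (S : Subgroup G) :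
    MonoidAlgebra R G :=
  Ring.inverse ((Nat.card S : R)) • ∑ᶠ g : S, MonoidAlgebra.of R G (g : G)

end

section GroupAlgebra

variable {R G : Type*} [CommRing R] [Group G] (S : Subgroup G)

lemma eSub_mul_of {g : G} (hg : g ∈ S) [Finite S] :
    eSub R S * MonoidAlgebra.of R G g = eSub R S := by
  have := Fintype.ofFinite S
  rw [eSub, smul_mul_assoc, finsum_eq_sum_of_fintype, Finset.sum_mul]
  congr 1
  exact Fintype.sum_equiv (Equiv.mulRight (⟨g, hg⟩ : S)) _ _ fun x => by
    simp

lemma of_mul_eSub {g : G} (hg : g ∈ S) [Finite S] :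
    MonoidAlgebra.of R G g * eSub R S = eSub R S := by
  have := Fintype.ofFinite S
  rw [eSub, mul_smul_comm, finsum_eq_sum_of_fintype, Finset.mul_sum]
  congr 1
  exact Fintype.sum_equiv (Equiv.mulLeft (⟨g, hg⟩ : S)) _ _ fun x => by
    simp

/-- If every `h ∈ S` is a product `a * b` with `x a x⁻¹ ∈ S` and `y⁻¹ b y ∈ S`, then averaging
over `S` between `x` and `y` has no effect. -/
lemma eSub_mul_of_mul_eSub_mul_of_mul_eSub [Finite S] (x y : G)
    (hxy : ∀ h ∈ S, ∃ a b, h = a * b ∧ x * a * x⁻¹ ∈ S ∧ y⁻¹ * b * y ∈ S) :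
    eSub R S * MonoidAlgebra.of R G x * eSub R S * MonoidAlgebra.of R G y * eSub R S
      = eSub R S * MonoidAlgebra.of R G (x * y) * eSub R S := by
  have hfin := Fintype.ofFinite S
  have key : ∀ h ∈ S, eSub R S * MonoidAlgebra.of R G x * MonoidAlgebra.of R G h *
      MonoidAlgebra.of R G y * eSub R S = eSub R S * MonoidAlgebra.of R G (x * y) * eSub R S := by
    intro h hh
    obtain ⟨a, b, rfl, ha, hb⟩ := hxy h hh
    have : x * (a * b) * y = x * a * x⁻¹ * (x * y) * (y⁻¹ * b * y) := by group
    calc _ = eSub R S * MonoidAlgebra.of R G (x * (a * b) * y) * eSub R S := by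
            simp only [map_mul, mul_assoc]
      _ = (eSub R S * MonoidAlgebra.of R G (x * a * x⁻¹)) * MonoidAlgebra.of R G (x * y) *
            (MonoidAlgebra.of R G (y⁻¹ * b * y) * eSub R S) := by
            rw [this]; simp only [map_mul, mul_assoc]
      _ = _ := by rw [eSub_mul_of S ha, of_mul_eSub S hb]
  by_cases hu : IsUnit (Nat.card S : R)
  · conv_lhs =>
      enter [1, 1, 2]
      rw [eSub, finsum_eq_sum_of_fintype]
    simp only [mul_smul_comm, smul_mul_assoc, Finset.mul_sum, Finset.sum_mul]
    rw [Finset.sum_congr rfl fun h _ => key h.1 h.2, Finset.sum_const, Finset.card_univ,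
      ← Nat.card_eq_fintype_card, ← Nat.cast_smul_eq_nsmul R, smul_smul,
      Ring.inverse_mul_cancel _ hu, one_smul]
  · have he : eSub R S = 0 := by rw [eSub, Ring.inverse_non_unit _ hu, zero_smul]
    simp only [he, mul_zero]

lemma eSub_mul_self [Finite S] : eSub R S * eSub R S = eSub R S := by
  have := Fintype.ofFinite S
  by_cases hu : IsUnit (Nat.card S : R)
  · conv_lhs =>
      enter [2]
      rw [eSub, finsum_eq_sum_of_fintype]
    rw [mul_smul_comm, Finset.mul_sum, Finset.sum_congr rfl fun h _ => eSub_mul_of S h.2,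
      Finset.sum_const, Finset.card_univ,
      ← Nat.card_eq_fintype_card, ← Nat.cast_smul_eq_nsmul R, smul_smul,
      Ring.inverse_mul_cancel _ hu, one_smul]
  · have he : eSub R S = 0 := by rw [eSub, Ring.inverse_non_unit _ hu, zero_smul]
    simp only [he, mul_zero]

end GroupAlgebra

section UnitaryGroup

variable {F : Type*} [Field F] {φ : F →+* F} {n : ℕ}

/-- The conjugate transpose of `M` along the anti-diagonal, `J · ᵗ(φ M) · J`. -/
def antiStar (φ : F →+* F) (M : Matrix (Fin n) (Fin n) F) : Matrix (Fin n) (Fin n) F :=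
  Matrix.of fun i j => φ (M j.rev i.rev)

lemma Jmat_mul_mul_Jmat (M : Matrix (Fin n) (Fin n) F) (i j : Fin n) :
    (Jmat F n * M * Jmat F n) i j = M i.rev j.rev := by
  have hrev (k : Fin n) : j = k.rev ↔ k = j.rev := by
    rw [← Fin.rev_eq_iff, eq_comm]
  simp [Matrix.mul_apply, Jmat, hrev]

lemma mem_GU_iff (g : GL (Fin n) F) : g ∈ GU F φ n ↔ antiStar φ g.val * g.val = 1 := by
  have hstar : (twistedFrobenius F φ n g)⁻¹.val = antiStar φ g.val := by
    have : (twistedFrobenius F φ n g)⁻¹ =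
        Junit F n * (transposeInvHom F n (Matrix.GeneralLinearGroup.map φ g))⁻¹ *
          (Junit F n)⁻¹ := by
      simp [twistedFrobenius, mul_assoc]
    rw [this]
    ext i j
    exact Jmat_mul_mul_Jmat _ i j
  rw [← hstar, ← Units.val_mul, Units.val_eq_one, inv_mul_eq_one]
  rfl

/-- The subgroup of upper triangular matrices in the unitary group. -/
def borelGU (φ : F →+* F) (n : ℕ) : Subgroup (GU F φ n) where
  carrier := {g | g.1.val.BlockTriangular id}
  one_mem' := Matrix.blockTriangular_one
  mul_mem' ha hb := ha.mul hb
  inv_mem' {g} hg := by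
    have : Invertible g.1.val := g.1.invertible
    have := Matrix.blockTriangular_inv_of_blockTriangular hg
    rwa [← Matrix.coe_units_inv] at this

/-- The `o`-th middle block of `M`, extended by the identity outside that block. -/
def midBlock (o : ℕ) (M : Matrix (Fin n) (Fin n) F) : Matrix (Fin n) (Fin n) F :=
  Matrix.of fun i j =>
    if (o ≤ (i : ℕ) ∧ (i : ℕ) + o < n) ∧ (o ≤ (j : ℕ) ∧ (j : ℕ) + o < n) then M i j
    else (1 : Matrix (Fin n) (Fin n) F) i j

lemma midBlock_one (o : ℕ) : midBlock o (1 : Matrix (Fin n) (Fin n) F) = 1 := by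
  ext i j
  simp [midBlock]

lemma midBlock_mul (o : ℕ) {M N : Matrix (Fin n) (Fin n) F} (hM : M.BlockTriangular id)
    (hN : N.BlockTriangular id) : midBlock o (M * N) = midBlock o M * midBlock o N := by
  ext i j
  rw [Matrix.mul_apply]
  simp only [midBlock, Matrix.of_apply]
  by_cases hi : o ≤ (i : ℕ) ∧ (i : ℕ) + o < n
  · by_cases hj : o ≤ (j : ℕ) ∧ (j : ℕ) + o < n
    · rw [if_pos ⟨hi, hj⟩, Matrix.mul_apply]
      refine Finset.sum_congr rfl fun k _ => ?_
      by_cases hk : o ≤ (k : ℕ) ∧ (k : ℕ) + o < n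
      · simp only [hi, hj, hk, and_self, if_true]
      · have hik : i ≠ k := by rintro rfl; exact hk hi
        simp only [hk, and_false, if_false, Matrix.one_apply_ne hik, zero_mul]
        rcases lt_or_ge k i with h | h
        · rw [hM h, zero_mul]
        · have : j < k := by
            rw [Fin.lt_def]; rw [Fin.le_def] at h; omega
          rw [hN this, mul_zero]
    · simp only [hj, and_false, if_false]
      rw [Finset.sum_eq_single j, Matrix.one_apply_eq, if_neg (by tauto), mul_one]
      · intro k _ hk
        rw [Matrix.one_apply_ne hk, mul_zero]
      · exact fun h => absurd (Finset.mem_univ _) h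
  · simp only [hi, false_and, if_false]
    rw [Finset.sum_eq_single i, Matrix.one_apply_eq, one_mul, if_neg (by tauto)]
    · intro k _ hk
      rw [Matrix.one_apply_ne hk.symm, zero_mul]
    · simp

lemma midBlock_midBlock (a b : ℕ) (M : Matrix (Fin n) (Fin n) F) :
    midBlock a (midBlock b M) = midBlock (max a b) M := by
  ext i j
  simp only [midBlock, Matrix.of_apply]
  split_ifs <;> first | rfl | omega

lemma midBlock_zero (M : Matrix (Fin n) (Fin n) F) : midBlock 0 M = M := by
  ext i j
  simp [midBlock]

lemma Matrix.BlockTriangular.midBlock {M : Matrix (Fin n) (Fin n) F}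
    (hM : M.BlockTriangular id) (o : ℕ) : (_root_.midBlock o M).BlockTriangular id := by
  intro i j h
  have := hM h
  have h' : i ≠ j := ne_of_gt h
  simp [_root_.midBlock, this, Matrix.one_apply_ne h']

lemma Matrix.BlockTriangular.antiStar {M : Matrix (Fin n) (Fin n) F}
    (hM : M.BlockTriangular id) : (_root_.antiStar φ M).BlockTriangular id := by
  intro i j h
  have : M j.rev i.rev = 0 := hM (Fin.rev_lt_rev.2 h)
  simp [_root_.antiStar, this]

lemma antiStar_midBlock (o : ℕ) (M : Matrix (Fin n) (Fin n) F) :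
    antiStar φ (midBlock o M) = midBlock o (antiStar φ M) := by
  ext i j
  simp only [midBlock, antiStar, Matrix.of_apply, Fin.val_rev, Matrix.one_apply, Fin.rev_inj]
  split_ifs <;> first | rfl | omega | simp

/-- The block truncation `midBlock` as an endomorphism of the Borel subgroup. -/
def borelGUMidBlock (φ : F →+* F) (n o : ℕ) : borelGU φ n →* borelGU φ n where
  toFun g := ⟨⟨⟨midBlock o g.1.1.val, midBlock o (g⁻¹).1.1.val,
      by
        rw [← midBlock_mul o g.2 (g⁻¹).2, ← Units.val_mul]
        simp [midBlock_one],
      by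
        rw [← midBlock_mul o (g⁻¹).2 g.2, ← Units.val_mul]
        simp [midBlock_one]⟩,
      (mem_GU_iff _).2 <| by
        rw [antiStar_midBlock, ← midBlock_mul o (Matrix.BlockTriangular.antiStar g.2) g.2,
          (mem_GU_iff _).1 g.1.2, midBlock_one]⟩,
      Matrix.BlockTriangular.midBlock g.2 o⟩
  map_one' := Subtype.ext <| Subtype.ext <| Units.ext <| midBlock_one o
  map_mul' g h := Subtype.ext <| Subtype.ext <| Units.ext <| midBlock_mul o g.2 h.2

lemma borelGUMidBlock_borelGUMidBlock (a b : ℕ) (g : borelGU φ n) :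
    borelGUMidBlock φ n a (borelGUMidBlock φ n b g) = borelGUMidBlock φ n (max a b) g :=
  Subtype.ext <| Subtype.ext <| Units.ext <| midBlock_midBlock a b _

lemma borelGUMidBlock_zero (g : borelGU φ n) : borelGUMidBlock φ n 0 g = g :=
  Subtype.ext <| Subtype.ext <| Units.ext <| midBlock_zero _

lemma borelGUMidBlock_val (o : ℕ) (g : borelGU φ n) :
    (borelGUMidBlock φ n o g).1.1.val = midBlock o g.1.1.val := rfl

lemma mem_Unr_of_borelGUMidBlock {r m o : ℕ} (ho : o < m) (v : borelGU φ (r + 2 * m))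
    (h1 : borelGUMidBlock φ _ o v = v) (h2 : borelGUMidBlock φ _ (o + 1) v = 1) :
    v.1 ∈ Unr F φ r m := by
  obtain ⟨k, rfl⟩ : ∃ k, m = o + 1 + k := ⟨m - (o + 1), by omega⟩
  have h1' := congrArg (fun g : borelGU φ _ => g.1.1.val) h1
  have h2' := congrArg (fun g : borelGU φ _ => g.1.1.val) h2
  simp only [borelGUMidBlock_val] at h1' h2'
  replace h1' := fun i j => congrFun (congrFun h1' i) j
  replace h2' := fun i j => congrFun (congrFun h2' i) j
  simp only [midBlock, Matrix.of_apply] at h1' h2'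
  refine Subgroup.subset_closure ⟨k, by omega, Matrix.of fun i j =>
    v.1.1.val ⟨i + o, by omega⟩ ⟨j + o, by omega⟩, ⟨?_, ?_, ?_⟩, ?_⟩
  · intro i j hij
    exact v.2 (Nat.add_lt_add_right hij o)
  · intro i hi hi'
    have := h2' ⟨i + o, by omega⟩ ⟨i + o, by omega⟩
    rw [if_pos (by simp only; omega)] at this
    simpa using this
  · intro i j hi hij hj
    have := h2' ⟨i + o, by omega⟩ ⟨j + o, by omega⟩
    rw [if_pos (by simp only; omega)] at this
    simpa [Matrix.one_apply, hij.ne] using this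
  · intro p q
    rw [cembFun]
    have e : o + 1 + k - 1 - k = o := by omega
    split_ifs with h h'
    · exact congrArg₂ v.1.1.val (Fin.ext (by simp only; omega)) (Fin.ext (by simp only; omega))
    · rw [← h1' p q, if_neg (by omega), Matrix.one_apply, if_pos (Fin.ext h')]
    · rw [← h1' p q, if_neg (by omega), Matrix.one_apply_ne (by simpa [Fin.ext_iff] using h')]

/-- `U_{n,r}` consists of the upper triangular unitary matrices with identity middle block. -/
lemma mem_Unr_iff {r m : ℕ} (g : GU F φ (r + 2 * m)) :
    g ∈ Unr F φ r m ↔ (∀ i j, j < i → g.1.val i j = 0) ∧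
      ∀ i j : Fin (r + 2 * m), m ≤ (i : ℕ) → (i : ℕ) < r + m → m ≤ (j : ℕ) → (j : ℕ) < r + m →
        g.1.val i j = (1 : Matrix (Fin (r + 2 * m)) (Fin (r + 2 * m)) F) i j := by
  have key : ∀ h : borelGU φ (r + 2 * m), borelGUMidBlock φ _ m h = 1 ↔
      ∀ i j : Fin (r + 2 * m), m ≤ (i : ℕ) → (i : ℕ) < r + m → m ≤ (j : ℕ) → (j : ℕ) < r + m →
        h.1.1.val i j = (1 : Matrix (Fin (r + 2 * m)) (Fin (r + 2 * m)) F) i j := by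
    intro h
    constructor
    · intro hh i j h1 h2 h3 h4
      have := congrArg (fun g : borelGU φ _ => g.1.1.val i j) hh
      simp only [borelGUMidBlock_val, midBlock, Matrix.of_apply] at this
      rw [if_pos (by omega)] at this
      exact this
    · intro hh
      refine Subtype.ext <| Subtype.ext <| Units.ext <| Matrix.ext fun i j => ?_
      simp only [borelGUMidBlock_val, midBlock, Matrix.of_apply]
      split_ifs with hij
      · exact hh i j (by omega) (by omega) (by omega) (by omega)
      · rfl
  constructor
  · intro hg
    have hle : Unr F φ r m ≤ ((borelGUMidBlock φ (r + 2 * m) m).ker).map (borelGU φ _).subtype := by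
      refine (Subgroup.closure_le _).2 ?_
      rintro g ⟨k, hk, u, ⟨hu1, hu2, hu3⟩, hg⟩
      have hb : g ∈ borelGU φ (r + 2 * m) := by
        intro i j hij
        have hij' : (j : ℕ) < i := hij
        rw [hg, cembFun]
        split_ifs
        · exact hu1 _ _ (by simp only; omega)
        · omega
        · rfl
      refine ⟨⟨g, hb⟩, (key _).2 ?_, rfl⟩
      intro i j h1 h2 h3 h4
      rw [hg, cembFun, dif_pos (by omega)]
      rcases lt_trichotomy i j with h | rfl | h
      · rw [Matrix.one_apply_ne h.ne]
        rw [Fin.lt_def] at h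
        exact hu3 _ _ (by simp only; omega) (by simp only; omega) (by simp only; omega)
      · rw [Matrix.one_apply_eq]
        exact hu2 _ (by simp only; omega) (by simp only; omega)
      · rw [Matrix.one_apply_ne h.ne']
        rw [Fin.lt_def] at h
        exact hu1 _ _ (by simp only; omega)
    obtain ⟨h, hh, rfl⟩ := hle hg
    exact ⟨fun i j hij => h.2 hij, (key h).1 hh⟩
  · rintro ⟨hg, hg'⟩
    set h : borelGU φ (r + 2 * m) := ⟨g, fun i j hij => hg i j hij⟩
    have hm : borelGUMidBlock φ _ m h = 1 := (key h).2 hg'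
    have step : ∀ d ≤ m, (borelGUMidBlock φ _ (m - d) h).1 ∈ Unr F φ r m := by
      intro d
      induction d with
      | zero => intro _; simp [hm]
      | succ d ih =>
        intro hd
        obtain ⟨o, ho⟩ : ∃ o, m - (d + 1) = o := ⟨_, rfl⟩
        have ho' : m - d = o + 1 := by omega
        have ih' := ih (by omega)
        rw [ho'] at ih'
        rw [ho]
        have hv := mem_Unr_of_borelGUMidBlock (o := o) (by omega)
          (borelGUMidBlock φ _ o h * (borelGUMidBlock φ _ (o + 1) h)⁻¹)
          (by simp [borelGUMidBlock_borelGUMidBlock])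
          (by simp [borelGUMidBlock_borelGUMidBlock])
        have := mul_mem hv ih'
        simpa using this
    have := step m le_rfl
    rwa [Nat.sub_self, borelGUMidBlock_zero] at this

lemma antiStar_mul_diag {g : GU F φ n} (hg : ∀ i j, j < i → g.1.val i j = 0) (i : Fin n) :
    antiStar φ g.1.val i i * g.1.val i i = 1 := by
  have hT : (antiStar φ g.1.val).BlockTriangular id :=
    Matrix.BlockTriangular.antiStar fun i j hij => hg i j hij
  have := congrFun (congrFun ((mem_GU_iff g.1).1 g.2) i) i
  rwa [Matrix.mul_apply, Finset.sum_eq_single i, Matrix.one_apply_eq] at this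
  · intro k _ hk
    rcases lt_or_gt_of_ne hk with hk | hk
    · rw [hT hk, zero_mul]
    · rw [hg _ _ hk, mul_zero]
  · simp

/-- The superdiagonal entries of an upper triangular unitary matrix vanish in mirrored pairs. -/
lemma apply_eq_zero_of_apply_rev_eq_zero {g : GU F φ n} (hg : ∀ i j, j < i → g.1.val i j = 0)
    {i j : Fin n} (hij : (j : ℕ) = i + 1) (h : g.1.val j.rev i.rev = 0) : g.1.val i j = 0 := by
  have hne : i ≠ j := by rintro rfl; omega
  have hT : (antiStar φ g.1.val).BlockTriangular id :=
    Matrix.BlockTriangular.antiStar fun i j hij => hg i j hij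
  have hij0 : antiStar φ g.1.val i i * g.1.val i j = 0 := by
    have := congrFun (congrFun ((mem_GU_iff g.1).1 g.2) i) j
    rwa [Matrix.mul_apply, Finset.sum_eq_single i, Matrix.one_apply_ne hne] at this
    · intro k _ hk
      rcases lt_or_gt_of_ne hk with hk | hk
      · rw [hT hk, zero_mul]
      · rcases eq_or_ne k j with rfl | hkj
        · simp [antiStar, h]
        · have : j < k := by
            rw [Fin.lt_def] at hk ⊢
            have := Fin.val_ne_of_ne hkj
            omega
          rw [hg _ _ this, mul_zero]
    · simp
  exact (mul_eq_zero.1 hij0).resolve_left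
    (left_ne_zero_of_mul ((antiStar_mul_diag hg i).trans_ne one_ne_zero))

/-- Root elements of the unitary group: elementary matrices corrected by their mirror image. -/
lemma exists_rootElement (hφ : ∀ x, φ (φ x) = x) {i j : Fin n} (hij : i ≠ j) (hi : i ≠ i.rev)
    (hj : j ≠ j.rev) (t : F) : ∃ g : GU F φ n, g.1.val =
      1 + Matrix.single i j t - Matrix.single j.rev i.rev (φ t) := by
  set A : Matrix (Fin n) (Fin n) F := Matrix.single i j t - Matrix.single j.rev i.rev (φ t)
    with hA
  have hAA : A * A = 0 := by
    have hij' : i.rev ≠ j.rev := Fin.rev_injective.ne hij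
    simp [hA, sub_mul, mul_sub, Matrix.single_mul_single_of_ne, hij.symm, hij', hi.symm, hj]
  have h1 : (1 + A) * (1 - A) = 1 := by
    rw [add_mul, mul_sub A, hAA]; simp
  have h2 : (1 - A) * (1 + A) = 1 := by
    rw [sub_mul, mul_add A, hAA]; simp
  have hstar : antiStar φ (1 + A) = 1 - A := by
    ext a b
    simp only [hA, antiStar, Matrix.of_apply, Matrix.add_apply, Matrix.sub_apply, map_add, map_sub,
      Matrix.one_apply, Matrix.single_apply, Fin.rev_inj, apply_ite φ, map_one, map_zero, hφ]
    have e1 : (i = b.rev ∧ j = a.rev) ↔ (j.rev = a ∧ i.rev = b) := by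
      rw [Fin.rev_eq_iff, Fin.rev_eq_iff, and_comm]
    have e2 : (j = b ∧ i = a) ↔ (i = a ∧ j = b) := and_comm
    simp only [e1, e2, eq_comm (a := b)]
    ring
  refine ⟨⟨⟨1 + A, 1 - A, h1, h2⟩, (mem_GU_iff _).2 ?_⟩, ?_⟩
  · rw [hstar]; exact h2
  · simp only [hA]; abel

lemma permMat_mul_apply (w : Equiv.Perm (Fin n)) (M : Matrix (Fin n) (Fin n) F) (i j : Fin n) :
    (permMat F n w * M) i j = M (w i) j := by
  simp [Matrix.mul_apply, permMat]

lemma conj_apply_of_eq_permMat {s g : GU F φ n} {w : Equiv.Perm (Fin n)}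
    (hs : s.1.val = permMat F n w) (i j : Fin n) :
    (s * g * s⁻¹).1.val i j = g.1.val (w i) (w j) := by
  have h : (s * g * s⁻¹).1.val * s.1.val = s.1.val * g.1.val := by
    rw [← Units.val_mul, ← Units.val_mul, ← Subgroup.coe_mul, ← Subgroup.coe_mul]
    simp
  have := congrFun (congrFun h i) (w j)
  rw [hs, permMat_mul_apply] at this
  rw [← this, Matrix.mul_apply, Finset.sum_eq_single j]
  · simp [permMat]
  · intro k _ hk
    simp [permMat, hk]
  · simp

lemma one_val_eq_permMat : (1 : GU F φ n).1.val = permMat F n 1 := by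
  ext i j
  by_cases h : i = j <;> simp [permMat, h]

lemma mul_val_eq_permMat {s t : GU F φ n} {v w : Equiv.Perm (Fin n)}
    (hs : s.1.val = permMat F n v) (ht : t.1.val = permMat F n w) :
    (s * t).1.val = permMat F n (w * v) := by
  ext i j
  rw [Subgroup.coe_mul, Units.val_mul, hs, permMat_mul_apply, ht]
  rfl

lemma GU_ext_of_eq_permMat {s t : GU F φ n} {w : Equiv.Perm (Fin n)}
    (hs : s.1.val = permMat F n w) (ht : t.1.val = permMat F n w) : s = t :=
  Subtype.ext <| Units.ext <| hs.trans ht.symm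

lemma swap_mul_swap_rev_apply {a b : Fin n} (hab : (b : ℕ) = a + 1)
    (hb : 2 * (b : ℕ) + 1 < n)
    {w : Equiv.Perm (Fin n)} (hw : w = Equiv.swap a b * Equiv.swap b.rev a.rev) (i : Fin n) :
    ((i : ℕ) = a ∧ (w i : ℕ) = b) ∨ ((i : ℕ) = b ∧ (w i : ℕ) = a) ∨
      ((i : ℕ) + b + 1 = n ∧ (w i : ℕ) + a + 1 = n) ∨
      ((i : ℕ) + a + 1 = n ∧ (w i : ℕ) + b + 1 = n) ∨
      ((i : ℕ) ≠ a ∧ (i : ℕ) ≠ b ∧ (i : ℕ) + b + 1 ≠ n ∧ (i : ℕ) + a + 1 ≠ n ∧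
        (w i : ℕ) = i) := by
  rw [hw, Equiv.Perm.mul_apply]
  rcases eq_or_ne i b.rev with rfl | h1
  · rw [Equiv.swap_apply_left, Equiv.swap_apply_of_ne_of_ne] <;>
      simp only [Ne, Fin.ext_iff, Fin.val_rev] <;> omega
  rcases eq_or_ne i a.rev with rfl | h2
  · rw [Equiv.swap_apply_right, Equiv.swap_apply_of_ne_of_ne] <;>
      simp only [Ne, Fin.ext_iff, Fin.val_rev] <;> omega
  rw [Equiv.swap_apply_of_ne_of_ne h1 h2]
  rw [Ne, Fin.ext_iff, Fin.val_rev] at h1 h2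
  rcases eq_or_ne i a with rfl | h3
  · rw [Equiv.swap_apply_left]; omega
  rcases eq_or_ne i b with rfl | h4
  · rw [Equiv.swap_apply_right]; omega
  rw [Equiv.swap_apply_of_ne_of_ne h3 h4]
  rw [Ne, Fin.ext_iff] at h3 h4
  omega

lemma swap_mul_swap_rev_mul_self {a b : Fin n} (hab : (b : ℕ) = a + 1)
    (hb : 2 * (b : ℕ) + 1 < n) {w : Equiv.Perm (Fin n)}
    (hw : w = Equiv.swap a b * Equiv.swap b.rev a.rev) : w * w = 1 := by
  ext i
  have h1 := swap_mul_swap_rev_apply hab hb hw i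
  have h2 := swap_mul_swap_rev_apply hab hb hw (w i)
  rw [Equiv.Perm.mul_apply, Equiv.Perm.one_apply]
  omega

lemma swap_mul_swap_rev_braid {a b c : Fin n} (hab : (b : ℕ) = a + 1) (hbc : (c : ℕ) = b + 1)
    (hc : 2 * (c : ℕ) + 1 < n) {v w : Equiv.Perm (Fin n)}
    (hv : v = Equiv.swap b c * Equiv.swap c.rev b.rev)
    (hw : w = Equiv.swap a b * Equiv.swap b.rev a.rev) : v * (w * v) = w * (v * w) := by
  have hv' := swap_mul_swap_rev_apply hbc hc hv
  have hw' := swap_mul_swap_rev_apply hab (by omega) hw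
  ext i
  simp only [Equiv.Perm.mul_apply]
  rcases hv' i with h1 | h1 | h1 | h1 | h1 <;> rcases hw' i with h2 | h2 | h2 | h2 | h2 <;>
    try (exfalso; omega)
  all_goals
    rcases hw' (v i) with h3 | h3 | h3 | h3 | h3 <;> try (exfalso; omega)
  all_goals
    rcases hv' (w i) with h4 | h4 | h4 | h4 | h4 <;> try (exfalso; omega)
  all_goals
    have h5 := hv' (w (v i))
    have h6 := hw' (v (w i))
    omega

/-- A factorization of `U_{n,r}` adapted to a permutation `x` that is length-additive with the
simple reflection `s`. -/
lemma exists_mul_of_mem_Unr (hφ : ∀ y, φ (φ y) = y) {r m : ℕ} {s x : GU F φ (r + 2 * m)}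
    {a b : Fin (r + 2 * m)} (hab : (b : ℕ) = a + 1) (hb : (b : ℕ) < m)
    (hs : s.1.val = permMat F _ (Equiv.swap a b * Equiv.swap b.rev a.rev))
    {w : Equiv.Perm (Fin (r + 2 * m))} (hx : x.1.val = permMat F _ w)
    (hfix : ∀ i : Fin (r + 2 * m), m ≤ (i : ℕ) → (i : ℕ) < r + m → w i = i)
    (hw : ∀ i j, w i = a → w j = b → i < j)
    (hw' : ∀ i j, w i = b.rev → w j = a.rev → i < j)
    (h : GU F φ (r + 2 * m)) (hh : h ∈ Unr F φ r m) :
    ∃ c d, h = c * d ∧ x * c * x⁻¹ ∈ Unr F φ r m ∧ s⁻¹ * d * s ∈ Unr F φ r m := by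
  have hT := ((mem_Unr_iff h).1 hh).1
  obtain ⟨c, hc⟩ := exists_rootElement hφ (i := a) (j := b) (by rw [Ne, Fin.ext_iff]; omega)
    (by rw [Ne, Fin.ext_iff, Fin.val_rev]; omega) (by rw [Ne, Fin.ext_iff, Fin.val_rev]; omega)
    (h.1.val a b / h.1.val b b)
  have hcc : ∀ (y : GU F φ (r + 2 * m)) (v : Equiv.Perm (Fin (r + 2 * m))),
      y.1.val = permMat F _ v →
      (∀ i : Fin (r + 2 * m), m ≤ (i : ℕ) → (i : ℕ) < r + m → v i = i) →
      (∀ i j, v i = a → v j = b → i < j) → (∀ i j, v i = b.rev → v j = a.rev → i < j) →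
      y * c * y⁻¹ ∈ Unr F φ r m := by
    intro y v hy hv hv1 hv2
    rw [mem_Unr_iff]
    simp only [conj_apply_of_eq_permMat hy, hc, Matrix.add_apply, Matrix.sub_apply,
      Matrix.single_apply, Matrix.one_apply, v.injective.eq_iff]
    refine ⟨fun i j hij => ?_, fun i j h1 h2 h3 h4 => ?_⟩
    · rw [if_neg hij.ne', if_neg, if_neg]
      · simp
      · rintro ⟨e1, e2⟩
        exact hij.asymm (hv2 i j e1.symm e2.symm)
      · rintro ⟨e1, e2⟩
        exact hij.asymm (hv1 i j e1.symm e2.symm)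
    · rw [hv i h1 h2, hv j h3 h4, if_neg (c := a = i ∧ b = j), if_neg (c := b.rev = i ∧ a.rev = j)]
      · simp
      · rintro ⟨rfl, -⟩
        rw [Fin.val_rev] at h2
        omega
      · rintro ⟨rfl, -⟩
        omega
  have hcm : c ∈ Unr F φ r m := by
    have := hcc 1 1 one_val_eq_permMat (fun _ _ _ => rfl)
      (by rintro i j rfl rfl; rw [Equiv.Perm.one_apply, Equiv.Perm.one_apply] at hab
          rw [Fin.lt_def]; omega)
      (by intro i j h1 h2; rw [Equiv.Perm.one_apply] at h1 h2
          rw [h1, h2, Fin.lt_def, Fin.val_rev, Fin.val_rev]; omega)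
    simpa using this
  obtain ⟨d, rfl⟩ : ∃ d, h = c * d := ⟨c⁻¹ * h, by group⟩
  have hd : d ∈ Unr F φ r m := (Subgroup.mul_mem_cancel_left _ hcm).1 hh
  refine ⟨c, d, rfl, hcc x w hx hfix hw hw', ?_⟩
  obtain ⟨hd1, hd2⟩ := (mem_Unr_iff d).1 hd
  have hmul : ∀ i : Fin (r + 2 * m), (i : ℕ) < m → (c * d).1.val i b = d.1.val i b +
      if i = a then (c * d).1.val a b / (c * d).1.val b b * d.1.val b b else 0 := by
    intro i hi
    have hi' : b.rev ≠ i := by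
      rw [Ne, Fin.ext_iff, Fin.val_rev]; omega
    set t := (c * d).1.val a b / (c * d).1.val b b
    rw [Subgroup.coe_mul, Units.val_mul, hc, sub_mul, add_mul, one_mul, Matrix.sub_apply,
      Matrix.add_apply, Matrix.single_mul_apply_of_ne _ _ _ _ _ hi'.symm, sub_zero]
    split_ifs with hia
    · rw [hia, Matrix.single_mul_apply_same]
    · rw [Matrix.single_mul_apply_of_ne _ _ _ _ _ hia]
  have hdb : (c * d).1.val b b = d.1.val b b := by
    rw [hmul b hb, if_neg (by rw [Fin.ext_iff]; omega), add_zero]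
  have hne : (c * d).1.val b b ≠ 0 :=
    right_ne_zero_of_mul ((antiStar_mul_diag hT b).trans_ne one_ne_zero)
  have hdab : d.1.val a b = 0 := by
    have := hmul a (by omega)
    rw [if_pos rfl, ← hdb, div_mul_cancel₀ _ hne] at this
    simpa using this
  have hdab' : d.1.val b.rev a.rev = 0 :=
    apply_eq_zero_of_apply_rev_eq_zero hd1 (by simp only [Fin.val_rev]; omega)
      (by rwa [Fin.rev_rev, Fin.rev_rev])
  have hss : s⁻¹ = s := by
    rw [inv_eq_iff_mul_eq_one]
    refine GU_ext_of_eq_permMat (w := 1) ?_ one_val_eq_permMat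
    rw [mul_val_eq_permMat hs hs, swap_mul_swap_rev_mul_self hab (by omega) rfl]
  have hconj : s⁻¹ * d * s = s * d * s⁻¹ := by rw [hss]
  rw [hconj, mem_Unr_iff]
  simp only [conj_apply_of_eq_permMat hs]
  set v := Equiv.swap a b * Equiv.swap b.rev a.rev with hv
  have hval := swap_mul_swap_rev_apply hab (by omega) hv
  refine ⟨fun i j hij => ?_, fun i j h1 h2 h3 h4 => ?_⟩
  · have hcases : v j < v i ∨ (v i = a ∧ v j = b) ∨ (v i = b.rev ∧ v j = a.rev) := by
      have h1 := hval i
      have h2 := hval j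
      simp only [Fin.lt_def, Fin.ext_iff, Fin.val_rev] at hij ⊢
      omega
    rcases hcases with h | ⟨h1, h2⟩ | ⟨h1, h2⟩
    · exact hd1 _ _ h
    · rw [h1, h2, hdab]
    · rw [h1, h2, hdab']
  · have e1 : v i = i := by
      have := hval i
      rw [Fin.ext_iff]; omega
    have e2 : v j = j := by
      have := hval j
      rw [Fin.ext_iff]; omega
    rw [e1, e2]
    exact hd2 i j h1 h2 h3 h4

end UnitaryGroup

theorem statement5
    {F : Type*} [Field F] [Fintype F] [DecidableEq F]
    {R : Type*} [CommRing R]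
    (p k q : ℕ) (hp : Nat.Prime p) (hk : 0 < k) (hq : q = p ^ k)
    (hcard : Fintype.card F = q ^ 2)
    (φ : F →+* F) (hφ : ∀ x : F, φ x = x ^ q)
    (hR : IsUnit ((q : R) * ((q : R) ^ 2 - 1)))
    (r : ℕ)
    (σ₁ σ₂ : GU F φ (r + 2 * 3))
    (hσ₁ : ((σ₁ : GL (Fin (r + 2 * 3)) F) : Matrix (Fin (r + 2 * 3)) (Fin (r + 2 * 3)) F)
        = permMat F (r + 2 * 3)
            (Equiv.swap ⟨1, by omega⟩ ⟨2, by omega⟩ *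
             Equiv.swap ⟨r + 3, by omega⟩ ⟨r + 4, by omega⟩))
    (hσ₂ : ((σ₂ : GL (Fin (r + 2 * 3)) F) : Matrix (Fin (r + 2 * 3)) (Fin (r + 2 * 3)) F)
        = permMat F (r + 2 * 3)
            (Equiv.swap ⟨0, by omega⟩ ⟨1, by omega⟩ *
             Equiv.swap ⟨r + 4, by omega⟩ ⟨r + 5, by omega⟩)) :
    let e : MonoidAlgebra R ↥(GU F φ (r + 2 * 3)) := eSub R (Unr F φ r 3)
    let T₁ : MonoidAlgebra R ↥(GU F φ (r + 2 * 3)) :=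
      (q : R) ^ 2 • (e * MonoidAlgebra.of R ↥(GU F φ (r + 2 * 3)) σ₁ * e)
    let T₂ : MonoidAlgebra R ↥(GU F φ (r + 2 * 3)) :=
      (q : R) ^ 2 • (e * MonoidAlgebra.of R ↥(GU F φ (r + 2 * 3)) σ₂ * e)
    T₁ * T₂ * T₁ = T₂ * T₁ * T₂ := by
  have hφφ : ∀ y, φ (φ y) = y := fun y => by
    rw [hφ, hφ, ← pow_mul, ← sq, ← hcard, FiniteField.pow_card]
  obtain ⟨i0, h0⟩ : ∃ i : Fin (r + 2 * 3), i = ⟨0, by omega⟩ := ⟨_, rfl⟩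
  obtain ⟨i1, h1⟩ : ∃ i : Fin (r + 2 * 3), i = ⟨1, by omega⟩ := ⟨_, rfl⟩
  obtain ⟨i2, h2⟩ : ∃ i : Fin (r + 2 * 3), i = ⟨2, by omega⟩ := ⟨_, rfl⟩
  have e0 : (⟨r + 5, by omega⟩ : Fin (r + 2 * 3)) = i0.rev := by
    rw [h0]; ext; simp
  have e1 : (⟨r + 4, by omega⟩ : Fin (r + 2 * 3)) = i1.rev := by
    rw [h1]; ext; simp
  have e2 : (⟨r + 3, by omega⟩ : Fin (r + 2 * 3)) = i2.rev := by
    rw [h2]; ext; simp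
  rw [← h1, ← h2, e1, e2] at hσ₁
  rw [← h0, ← h1, e0, e1] at hσ₂
  replace h0 : (i0 : ℕ) = 0 := by rw [h0]
  replace h1 : (i1 : ℕ) = 1 := by rw [h1]
  replace h2 : (i2 : ℕ) = 2 := by rw [h2]
  have hf₁ := fun x w => exists_mul_of_mem_Unr hφφ (m := 3) (s := σ₁) (x := x) (a := i1) (b := i2)
    (w := w) (by omega) (by omega) hσ₁
  have hf₂ := fun x w => exists_mul_of_mem_Unr hφφ (m := 3) (s := σ₂) (x := x) (a := i0) (b := i1)
    (w := w) (by omega) (by omega) hσ₂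
  obtain ⟨w₁, hw₁⟩ : ∃ w, w = Equiv.swap i1 i2 * Equiv.swap i2.rev i1.rev := ⟨_, rfl⟩
  obtain ⟨w₂, hw₂⟩ : ∃ w, w = Equiv.swap i0 i1 * Equiv.swap i1.rev i0.rev := ⟨_, rfl⟩
  have hv₁ := swap_mul_swap_rev_apply (by omega) (by omega) hw₁
  have hv₂ := swap_mul_swap_rev_apply (by omega) (by omega) hw₂
  rw [← hw₁] at hσ₁
  rw [← hw₂] at hσ₂
  simp only [h0, h1, h2] at hv₁ hv₂
  have hσ₁₂ := mul_val_eq_permMat hσ₁ hσ₂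
  have hσ₂₁ := mul_val_eq_permMat hσ₂ hσ₁
  have hbraid : σ₁ * σ₂ * σ₁ = σ₂ * σ₁ * σ₂ := by
    refine GU_ext_of_eq_permMat (mul_val_eq_permMat hσ₁₂ hσ₁) ?_
    rw [mul_val_eq_permMat hσ₂₁ hσ₂]
    rw [swap_mul_swap_rev_braid (by omega) (by omega) (by omega) hw₁ hw₂]
  have hf₁σ₂ := hf₁ _ _ hσ₂
    (fun i _ _ => by have := hv₂ i; rw [Fin.ext_iff]; omega)
    (fun i j hi hj => by
      have := hv₂ i; have := hv₂ j
      rw [Fin.ext_iff] at hi hj; rw [Fin.lt_def]; omega)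
    (fun i j hi hj => by
      have := hv₂ i; have := hv₂ j
      rw [Fin.ext_iff, Fin.val_rev] at hi hj; rw [Fin.lt_def]; omega)
  have hf₂σ₁ := hf₂ _ _ hσ₁
    (fun i _ _ => by have := hv₁ i; rw [Fin.ext_iff]; omega)
    (fun i j hi hj => by
      have := hv₁ i; have := hv₁ j
      rw [Fin.ext_iff] at hi hj; rw [Fin.lt_def]; omega)
    (fun i j hi hj => by
      have := hv₁ i; have := hv₁ j
      rw [Fin.ext_iff, Fin.val_rev] at hi hj; rw [Fin.lt_def]; omega)
  have hf₁σ₁₂ := hf₁ _ _ hσ₁₂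
    (fun i _ _ => by
      have h := hv₁ i
      have h' : w₁ i = i := by rw [Fin.ext_iff]; omega
      have := hv₂ i
      rw [Equiv.Perm.mul_apply, h', Fin.ext_iff]; omega)
    (fun i j hi hj => by
      rw [Equiv.Perm.mul_apply, Fin.ext_iff] at hi hj
      have hi' : (i : ℕ) = 0 := by have := hv₁ i; have := hv₂ (w₁ i); omega
      have hj' : (j : ℕ) = 1 := by have := hv₁ j; have := hv₂ (w₁ j); omega
      rw [Fin.lt_def]; omega)
    (fun i j hi hj => by
      rw [Equiv.Perm.mul_apply, Fin.ext_iff, Fin.val_rev] at hi hj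
      have hi' : (i : ℕ) = r + 4 := by have := hv₁ i; have := hv₂ (w₁ i); omega
      have hj' : (j : ℕ) = r + 5 := by have := hv₁ j; have := hv₂ (w₁ j); omega
      rw [Fin.lt_def]; omega)
  have hf₂σ₂₁ := hf₂ _ _ hσ₂₁
    (fun i _ _ => by
      have h := hv₂ i
      have h' : w₂ i = i := by rw [Fin.ext_iff]; omega
      have := hv₁ i
      rw [Equiv.Perm.mul_apply, h', Fin.ext_iff]; omega)
    (fun i j hi hj => by
      rw [Equiv.Perm.mul_apply, Fin.ext_iff] at hi hj
      have hi' : (i : ℕ) = 1 := by have := hv₂ i; have := hv₁ (w₂ i); omega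
      have hj' : (j : ℕ) = 2 := by have := hv₂ j; have := hv₁ (w₂ j); omega
      rw [Fin.lt_def]; omega)
    (fun i j hi hj => by
      rw [Equiv.Perm.mul_apply, Fin.ext_iff, Fin.val_rev] at hi hj
      have hi' : (i : ℕ) = r + 3 := by have := hv₂ i; have := hv₁ (w₂ i); omega
      have hj' : (j : ℕ) = r + 4 := by have := hv₂ j; have := hv₁ (w₂ j); omega
      rw [Fin.lt_def]; omega)
  have h₁₂ := eSub_mul_of_mul_eSub_mul_of_mul_eSub (R := R) (Unr F φ r 3) σ₁ σ₂ hf₂σ₁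
  have h₂₁ := eSub_mul_of_mul_eSub_mul_of_mul_eSub (R := R) (Unr F φ r 3) σ₂ σ₁ hf₁σ₂
  have h₁₂₁ := eSub_mul_of_mul_eSub_mul_of_mul_eSub (R := R) (Unr F φ r 3) (σ₁ * σ₂) σ₁ hf₁σ₁₂
  have h₂₁₂ := eSub_mul_of_mul_eSub_mul_of_mul_eSub (R := R) (Unr F φ r 3) (σ₂ * σ₁) σ₂ hf₂σ₂₁
  intro e T₁ T₂
  have hee : ∀ x, e * (e * x) = e * x := fun x => by
    rw [← mul_assoc, eSub_mul_self]
  have hA : e * MonoidAlgebra.of R _ σ₁ * e * (e * MonoidAlgebra.of R _ σ₂ * e) *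
      (e * MonoidAlgebra.of R _ σ₁ * e) = e * MonoidAlgebra.of R _ (σ₁ * σ₂ * σ₁) * e := by
    rw [← h₁₂₁, ← h₁₂]
    simp only [mul_assoc, hee, e]
  have hB : e * MonoidAlgebra.of R _ σ₂ * e * (e * MonoidAlgebra.of R _ σ₁ * e) *
      (e * MonoidAlgebra.of R _ σ₂ * e) = e * MonoidAlgebra.of R _ (σ₂ * σ₁ * σ₂) * e := by
    rw [← h₂₁₂, ← h₂₁]
    simp only [mul_assoc, hee, e]
  simp only [T₁, T₂, smul_mul_assoc, mul_smul_comm]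
  rw [hA, hB, hbraid]
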